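/- Let λ > 0, M^λ_j = exp(λ·j²/4), and g_λ(x) = exp(−(ln x)²/λ) for x > 0, g_λ(x) = 0 for x ≤ 0. Then the sequence M^λ is increasing, logarithmically convex, satisfies the derivability condition sup_{j≥1}(M^λ_{j+1}/M^λ_j)^{1/j} < ∞, and is non-quasianalytic (∑_{j≥0} M^λ_j/((j+1)·M^λ_{j+1}) < ∞); moreover the function h = g_{2λ} is C^∞ on ℝ, satisfies h(x)² = g_λ(x) for all x (so h is a smooth root of the polynomial y² − g_λ(x) whose coefficients have germs in E_1(M^λ)), yet the germ of h at 0 does not belong to E_1(M^λ). In particular, smooth roots of polynomials with coefficients in a non-quasianalytic derivation-closed Denjoy–Carleman class need not belong to that class. -/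

import Mathlib

open Set Filter Topology

noncomputable section

/-- The germ at `0` of `h : ℝ → ℝ` belongs to the Denjoy–Carleman class `E₁(M)`. -/
def GermInDC (M : ℕ → ℝ) (h : ℝ → ℝ) : Prop :=
  ∃ ε > (0:ℝ), ∃ C > (0:ℝ), ∃ σ > (0:ℝ),
    ContDiffOn ℝ (⊤ : ℕ∞) h (Ioo (-ε) ε) ∧
    ∀ (j : ℕ), ∀ x ∈ Ioo (-ε) ε,
      |iteratedDeriv j h x| ≤ C * σ ^ j * (Nat.factorial j : ℝ) * M j

/-- The sequence `M^λ_j = exp(λ j²/4)`. -/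
def Mlam (lam : ℝ) : ℕ → ℝ := fun j => Real.exp (lam * (j:ℝ) ^ 2 / 4)

/-- The function `g_λ`. -/
def gfun (lam : ℝ) : ℝ → ℝ := fun x =>
  if 0 < x then Real.exp (-(Real.log x) ^ 2 / lam) else 0

/-- Complex extension of `g_λ` to the slit plane. -/
def Gc (lam : ℝ) : ℂ → ℂ := fun z => Complex.exp (-(Complex.log z) ^ 2 / (lam : ℂ))

/-- The derivatives of `g_λ`. -/
def Fd (lam : ℝ) (j : ℕ) : ℝ → ℝ := fun x =>
  if 0 < x then (iteratedDeriv j (Gc lam) (x : ℂ)).re else 0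

lemma Gc_analyticAt (lam : ℝ) {z : ℂ} (hz : z ∈ Complex.slitPlane) : AnalyticAt ℂ (Gc lam) z := by
  unfold Gc
  have := analyticAt_clog hz
  fun_prop

lemma Gc_norm_le {lam : ℝ} (hlam : 0 < lam) (n : ℕ) {z : ℂ} (hz : z ≠ 0) :
    ‖Gc lam z‖ ≤ Real.exp (Real.pi ^ 2 / lam) * Mlam lam n * ‖z‖ ^ n := by
  have hpos : 0 < ‖z‖ := norm_pos_iff.2 hz
  have h1 : ‖z‖ ^ n = Real.exp (n * Real.log ‖z‖) := by
    rw [Real.exp_nat_mul, Real.exp_log hpos]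
  unfold Gc Mlam
  rw [Complex.norm_exp, h1, ← Real.exp_add, ← Real.exp_add]
  apply Real.exp_le_exp.2
  have h2 : (-(Complex.log z) ^ 2 / (lam : ℂ)).re
      = (-(Real.log ‖z‖) ^ 2 + z.arg ^ 2) / lam := by
    rw [Complex.div_ofReal_re, sq, sq]
    simp [Complex.log_re, Complex.log_im]
    ring
  rw [h2]
  have ha : z.arg ^ 2 ≤ Real.pi ^ 2 := by
    rw [← sq_abs z.arg]
    have := Complex.abs_arg_le_pi z
    gcongr
  set L := Real.log ‖z‖
  have h3 : 0 ≤ (lam * n / 2 + L) ^ 2 / lam := by positivity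
  have h4 : (lam * n / 2 + L) ^ 2 / lam = lam * n ^ 2 / 4 + n * L + L ^ 2 / lam := by
    field_simp
    ring
  have h5 : z.arg ^ 2 / lam ≤ Real.pi ^ 2 / lam := by gcongr
  rw [add_div, neg_div]
  linarith

lemma Fd_bound {lam : ℝ} (hlam : 0 < lam) (j n : ℕ) {x : ℝ} (hx : 0 < x) :
    |Fd lam j x| ≤ j.factorial *
      (Real.exp (Real.pi ^ 2 / lam) * Mlam lam n * (3 * x / 2) ^ n) / (x / 2) ^ j := by
  have hball : ∀ z ∈ Metric.closedBall (x : ℂ) (x / 2), z ∈ Complex.slitPlane ∧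
      ‖z‖ ≤ 3 * x / 2 := by
    intro z hz
    rw [mem_closedBall_iff_norm] at hz
    constructor
    · left
      have := (Complex.abs_re_le_norm _).trans hz
      rw [Complex.sub_re, Complex.ofReal_re, abs_le] at this
      linarith
    · have := norm_le_norm_add_norm_sub' z (x : ℂ)
      rw [Complex.norm_real, Real.norm_of_nonneg hx.le] at this
      linarith
  unfold Fd
  rw [if_pos hx]
  refine (Complex.abs_re_le_norm _).trans ?_
  apply Complex.norm_iteratedDeriv_le_of_forall_mem_sphere_norm_le j (by linarith)
  · apply DifferentiableOn.diffContOnCl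
    rw [closure_ball _ (by positivity)]
    intro z hz
    exact (Gc_analyticAt lam (hball z hz).1).differentiableAt.differentiableWithinAt
  · intro z hz
    obtain ⟨h1, h2⟩ := hball z (Metric.sphere_subset_closedBall hz)
    refine (Gc_norm_le hlam n (Complex.slitPlane_ne_zero h1)).trans ?_
    have : 0 < Mlam lam n := Real.exp_pos _
    gcongr

lemma Fd_bound_sq {lam : ℝ} (hlam : 0 < lam) (j : ℕ) :
    ∃ K : ℝ, ∀ x : ℝ, |Fd lam j x| ≤ K * x ^ 2 := by
  have hM : 0 < Mlam lam (j + 2) := Real.exp_pos _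
  refine ⟨j.factorial * (Real.exp (Real.pi ^ 2 / lam) * Mlam lam (j + 2)) * 3 ^ j * (9 / 4),
    fun x => ?_⟩
  by_cases hx : 0 < x
  · refine (Fd_bound hlam j (j + 2) hx).trans (le_of_eq ?_)
    rw [pow_add, show 3 * x / 2 = 3 * (x / 2) by ring, mul_pow 3 (x / 2) j]
    field_simp
    ring
  · simp only [Fd, if_neg hx, abs_zero]
    positivity

lemma Fd_hasDerivAt {lam : ℝ} (hlam : 0 < lam) (j : ℕ) (x : ℝ) :
    HasDerivAt (Fd lam j) (Fd lam (j + 1) x) x := by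
  rcases lt_trichotomy x 0 with hx | rfl | hx
  · have : Fd lam j =ᶠ[𝓝 x] fun _ => 0 := by
      filter_upwards [Iio_mem_nhds hx] with y hy
      have hy' : y < 0 := hy
      simp [Fd, not_lt.2 hy'.le]
    have h0 : Fd lam (j + 1) x = 0 := by simp [Fd, not_lt.2 hx.le]
    rw [h0]
    exact (hasDerivAt_const x (0 : ℝ)).congr_of_eventuallyEq this
  · obtain ⟨K, hK⟩ := Fd_bound_sq hlam j
    have h0 : ∀ j, Fd lam j 0 = 0 := by intro j; simp [Fd]
    rw [h0, hasDerivAt_iff_isLittleO]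
    have hO : (fun y : ℝ => Fd lam j y) =O[𝓝 0] fun y : ℝ => y ^ 2 := by
      apply Asymptotics.IsBigO.of_bound K
      filter_upwards with y
      simpa using hK y
    have := hO.trans_isLittleO (Asymptotics.isLittleO_pow_id (𝕜 := ℝ) one_lt_two)
    simpa [h0] using this
  · have hs : (x : ℂ) ∈ Complex.slitPlane := by left; simpa using hx
    have han : AnalyticAt ℂ (iteratedDeriv j (Gc lam)) (x : ℂ) := by
      rw [iteratedDeriv_eq_iterate]
      exact (Gc_analyticAt lam hs).iterated_deriv j
    have h1 := han.differentiableAt.hasDerivAt.real_of_complex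
    rw [← iteratedDeriv_succ] at h1
    have h2 : Fd lam (j + 1) x = (iteratedDeriv (j + 1) (Gc lam) (x : ℂ)).re := by
      simp [Fd, hx]
    rw [h2]
    apply h1.congr_of_eventuallyEq
    filter_upwards [Ioi_mem_nhds hx] with y hy
    have hy' : 0 < y := hy
    simp [Fd, hy']

lemma Fd_zero (lam : ℝ) : Fd lam 0 = gfun lam := by
  funext x
  unfold Fd gfun
  split_ifs with hx
  · simp only [iteratedDeriv_zero, Gc]
    rw [← Complex.ofReal_log hx.le]
    have : (-(Real.log x : ℂ) ^ 2 / (lam : ℂ)) = ((-(Real.log x) ^ 2 / lam : ℝ) : ℂ) := by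
      push_cast; rfl
    rw [this, ← Complex.ofReal_exp, Complex.ofReal_re]
  · rfl

lemma iteratedDeriv_gfun {lam : ℝ} (hlam : 0 < lam) (j : ℕ) :
    iteratedDeriv j (gfun lam) = Fd lam j := by
  induction j with
  | zero => rw [iteratedDeriv_zero, Fd_zero]
  | succ j ih =>
    rw [iteratedDeriv_succ, ih]
    funext x
    exact (Fd_hasDerivAt hlam j x).deriv

lemma gfun_contDiff {lam : ℝ} (hlam : 0 < lam) : ContDiff ℝ (⊤ : ℕ∞) (gfun lam) := by
  apply contDiff_of_differentiable_iteratedDeriv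
  intro m _
  rw [iteratedDeriv_gfun hlam]
  exact fun x => (Fd_hasDerivAt hlam m x).differentiableAt

lemma gfun_germ {lam : ℝ} (hlam : 0 < lam) : GermInDC (Mlam lam) (gfun lam) := by
  refine ⟨1, one_pos, Real.exp (Real.pi ^ 2 / lam), Real.exp_pos _, 3, by norm_num,
    (gfun_contDiff hlam).contDiffOn, fun j x _ => ?_⟩
  have hM : 0 < Mlam lam j := Real.exp_pos _
  rw [iteratedDeriv_gfun hlam]
  by_cases hx : 0 < x
  · refine (Fd_bound hlam j j hx).trans (le_of_eq ?_)
    rw [show 3 * x / 2 = 3 * (x / 2) by ring, mul_pow 3 (x / 2) j]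
    field_simp
  · simp only [Fd, if_neg hx, abs_zero]
    positivity

lemma taylor_bound {lam : ℝ} (hlam : 0 < lam) {B ε : ℝ} (j : ℕ)
    (hB : ∀ x ∈ Ico 0 ε, |Fd lam j x| ≤ B) (i : ℕ) :
    ∀ k, k + i = j → ∀ x ∈ Ico 0 ε, |Fd lam k x| ≤ B * x ^ i / i.factorial := by
  induction i with
  | zero => intro k hk x hx; have : k = j := by omega
            subst this; simpa using hB x hx
  | succ i ih =>
    intro k hk x hx
    have hb := ih (k + 1) (by omega)
    have key := image_norm_le_of_norm_deriv_right_le_deriv_boundary (a := 0) (b := x)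
      (f := Fd lam k) (f' := Fd lam (k + 1)) (B := fun y => B * y ^ (i + 1) / (i + 1).factorial)
      (B' := fun y => B * y ^ i / i.factorial)
      (fun y _ => (Fd_hasDerivAt hlam k y).continuousAt.continuousWithinAt)
      (fun y _ => (Fd_hasDerivAt hlam k y).hasDerivWithinAt)
      (by simp [Fd])
      (fun y => by
        have h := ((hasDerivAt_pow (i + 1) y).const_mul B).div_const ((i + 1).factorial : ℝ)
        refine h.congr_deriv ?_
        rw [Nat.factorial_succ]
        push_cast
        have : (i.factorial : ℝ) ≠ 0 := by positivity
        field_simp)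
      (fun y hy => hb y ⟨hy.1, hy.2.trans hx.2⟩)
    exact key ⟨hx.1, le_rfl⟩

lemma gfun_not_germ {lam : ℝ} (hlam : 0 < lam) : ¬ GermInDC (Mlam lam) (gfun (2 * lam)) := by
  rintro ⟨ε, hε, C, hC, σ, hσ, -, hb⟩
  have h2 : 0 < 2 * lam := by positivity
  have hmain : ∀ j : ℕ, Real.exp (-(lam * j / 2)) < ε →
      lam * j ^ 2 / 8 ≤ Real.log C + j * Real.log σ := by
    intro j hj
    set x := Real.exp (-(lam * j / 2)) with hx
    have hxp : 0 < x := Real.exp_pos _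
    have := taylor_bound h2 (ε := ε) (B := C * σ ^ j * (Nat.factorial j : ℝ) * Mlam lam j) j
      (fun y hy => by
        rw [← iteratedDeriv_gfun h2]
        exact hb j y ⟨by linarith [hy.1], hy.2⟩) j 0 (by omega) x ⟨hxp.le, hj⟩
    rw [Fd_zero] at this
    have hf : (j.factorial : ℝ) ≠ 0 := by positivity
    have h3 : C * σ ^ j * (Nat.factorial j : ℝ) * Mlam lam j * x ^ j / j.factorial
        = Real.exp (Real.log C + j * Real.log σ + lam * j ^ 2 / 4 + j * (-(lam * j / 2))) := by
      rw [Real.exp_add, Real.exp_add, Real.exp_add, Real.exp_log hC, Real.exp_nat_mul,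
        Real.exp_log hσ, Real.exp_nat_mul, ← hx, Mlam]
      field_simp
    rw [h3, gfun, if_pos hxp, abs_of_pos (Real.exp_pos _), Real.exp_le_exp, hx, Real.log_exp] at this
    have h4 : -(-(lam * j / 2)) ^ 2 / (2 * lam) = - (lam * j ^ 2 / 8) := by
      field_simp
      ring
    rw [h4] at this
    nlinarith [this]
  have hlin : Tendsto (fun j : ℕ => lam * (j : ℝ) / 8) atTop atTop :=
    (tendsto_natCast_atTop_atTop.const_mul_atTop hlam).atTop_div_const (by norm_num)
  have he1 : ∀ᶠ j : ℕ in atTop, Real.exp (-(lam * j / 2)) < ε := by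
    filter_upwards [hlin.eventually_gt_atTop (-Real.log ε / 4)] with j hj
    rw [← Real.lt_log_iff_exp_lt hε]
    linarith
  obtain ⟨j, hj1, hj2, hj3⟩ := (he1.and ((hlin.eventually_gt_atTop
    (|Real.log C| + Real.log σ)).and (eventually_ge_atTop 1))).exists
  have h := hmain j hj1
  have hj : (1 : ℝ) ≤ j := by exact_mod_cast hj3
  have h5 := le_abs_self (Real.log C)
  have h6 := abs_nonneg (Real.log C)
  have h7 : (|Real.log C| + Real.log σ) * j < lam * j / 8 * j := by gcongr
  nlinarith

/-- Counter-example in the non-quasianalytic case: `M^λ` is increasing,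
log-convex, derivation-closed and non-quasianalytic; `h = g_{2λ}` is a smooth
square root of `g_λ ∈ E₁(M^λ)`, yet `h ∉ E₁(M^λ)`. -/
theorem counterexample_nonquasianalytic (lam : ℝ) (hlam : 0 < lam) :
    Monotone (Mlam lam) ∧
    (∀ j : ℕ, (Mlam lam (j+1)) ^ 2 ≤ Mlam lam j * Mlam lam (j+2)) ∧
    (∃ A : ℝ, ∀ j : ℕ, 1 ≤ j →
      (Mlam lam (j+1) / Mlam lam j) ^ ((1:ℝ)/(j:ℝ)) ≤ A) ∧
    Summable (fun j : ℕ => Mlam lam j / (((j:ℝ)+1) * Mlam lam (j+1))) ∧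
    GermInDC (Mlam lam) (gfun lam) ∧
    ContDiff ℝ (⊤ : ℕ∞) (gfun (2 * lam)) ∧
    (∀ x : ℝ, gfun (2 * lam) x ^ 2 = gfun lam x) ∧
    ¬ GermInDC (Mlam lam) (gfun (2 * lam)) := by
  have hsum : ∀ j : ℕ, Mlam lam j / Mlam lam (j+1) = Real.exp (-(lam / 4)) * Real.exp (-(lam / 2)) ^ j := by
    intro j
    rw [Mlam, Mlam, ← Real.exp_sub, ← Real.exp_nat_mul, ← Real.exp_add]
    push_cast
    ring_nf
  refine ⟨?_, ?_, ?_, ?_, gfun_germ hlam, gfun_contDiff (by positivity), ?_, gfun_not_germ hlam⟩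
  · intro a b hab
    apply Real.exp_le_exp.2
    gcongr
  · intro j
    rw [Mlam, ← Real.exp_nat_mul, Mlam, Mlam, ← Real.exp_add]
    apply Real.exp_le_exp.2
    push_cast
    nlinarith
  · refine ⟨Real.exp (3 * lam / 4), fun j hj => ?_⟩
    have hj' : (1 : ℝ) ≤ j := by exact_mod_cast hj
    rw [Mlam, Mlam, ← Real.exp_sub, ← Real.exp_mul]
    apply Real.exp_le_exp.2
    rw [mul_one_div, div_le_iff₀ (by positivity)]
    push_cast
    nlinarith
  · have hg : Summable (fun j : ℕ => Real.exp (-(lam / 4)) * Real.exp (-(lam / 2)) ^ j) :=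
      (summable_geometric_of_lt_one (Real.exp_pos _).le
        (by rw [← Real.exp_zero]; exact Real.exp_lt_exp.2 (by linarith))).mul_left _
    refine Summable.of_nonneg_of_le (fun j => ?_) (fun j => ?_) hg
    · have h1 : 0 < Mlam lam j := Real.exp_pos _
      have h2 : 0 < Mlam lam (j + 1) := Real.exp_pos _
      positivity
    · have h1 : 0 < Mlam lam j := Real.exp_pos _
      have h2 : 0 < Mlam lam (j + 1) := Real.exp_pos _
      rw [← hsum]
      apply div_le_div_of_nonneg_left h1.le h2
      have : (0 : ℝ) ≤ j := by positivity
      nlinarith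
  · intro x
    unfold gfun
    split_ifs with hx
    · rw [← Real.exp_nat_mul]
      congr 1
      push_cast
      field_simp
    · simp
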